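/- arXiv:1409.7322 — 2 statements merged into one kernel-verified Lean document; each statement's English description precedes it below -/
import Mathlib

section
/- The 3x+1 conjecture holds if and only if for every positive integer n, the Turing machine M3 halts when started from the initial configuration ωb (A 1) 1^{n−1} bω (the number n written in unary). -/
namespace Collatz

/-- The 3x+1 function. -/
def T (x : ℕ) : ℕ := if x % 2 = 0 then x / 2 else (3 * x + 1) / 2

/-- The 3x+1 conjecture: iterating `T` from any positive integer
eventually reaches the loop `2 ↦ 1 ↦ 2`. -/
def CollatzConjecture : Prop :=
  ∀ x : ℕ, 0 < x → ∃ k : ℕ, T^[k] x = 2 ∧ T^[k + 1] x = 1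

inductive St | A | B | C | H
  deriving DecidableEq

inductive Sym | sb | s1 | sx | sr | su | sv | sy | sz | st | sk
  deriving DecidableEq

open St Sym

/-- Transition table of the Turing machine `M3`
(`true` = move right, `false` = move left); `H` is the halting state. -/
def delta : St → Sym → Option (Sym × Bool × St)
  | A, sb => some (sb, true, A)
  | A, s1 => some (sx, true, C)
  | A, sx => some (s1, false, A)
  | A, sr => some (sk, true, B)
  | A, su => some (sx, true, A)
  | A, sv => some (sx, true, A)
  | A, sy => some (sr, false, A)
  | A, sz => some (sr, false, A)
  | A, st => some (sy, true, A)
  | A, sk => none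
  | B, sb => some (sz, false, B)
  | B, s1 => some (su, true, B)
  | B, sx => some (sx, true, B)
  | B, sr => some (sy, true, B)
  | B, su => some (sv, false, B)
  | B, sv => some (su, true, A)
  | B, sy => some (st, false, B)
  | B, sz => some (s1, false, A)
  | B, st => some (sx, true, B)
  | B, sk => some (sb, true, B)
  | C, sb => some (sb, false, H)
  | C, s1 => some (su, true, B)
  | C, sr => some (sy, true, B)
  | C, _  => none
  | H, _  => none

structure Cfg where
  state : St
  head : ℤ
  tape : ℤ → Sym

/-- One step of the machine; `none` when the transition is undefined
(in particular in the halting state, which has no transitions).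
In `delta`, the `Bool` component is the direction: `true` = right, `false` = left. -/
def step (c : Cfg) : Option Cfg :=
  (delta c.state (c.tape c.head)).map fun t =>
    ⟨t.2.2, c.head + (if t.2.1 then 1 else -1), Function.update c.tape c.head t.1⟩

/-- `steps n c` is the configuration after `n` steps from `c`
(`none` if the machine has halted meanwhile). -/
def steps : ℕ → Cfg → Option Cfg
  | 0, c => some c
  | n + 1, c => (step c).bind (steps n)

/-- The tape holding the word `w` at positions `0, …, w.length - 1`,
and the blank symbol everywhere else. -/
def tapeOf (w : List Sym) : ℤ → Sym :=
  fun i => if 0 ≤ i then w.getD i.toNat sb else sb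

/-- `c` is the configuration `ωb u (q s) v bω`, where `w = u ++ s :: v` and
`pos = u.length` (i.e. the tape holds exactly the word `w` surrounded by blanks,
the machine is in state `q`, and the head scans the symbol of `w` at index `pos`). -/
def IsConfig (c : Cfg) (q : St) (w : List Sym) (pos : ℕ) : Prop :=
  c.state = q ∧ ∃ d : ℤ, c.head = d + pos ∧ c.tape = fun i => tapeOf w (i - d)

/-- The machine eventually reaches the configuration `ωb u (q s) v bω`. -/
def Reaches (c : Cfg) (q : St) (w : List Sym) (pos : ℕ) : Prop :=
  ∃ t : ℕ, ∃ c' : Cfg, steps t c = some c' ∧ IsConfig c' q w pos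

/-- The machine halts when started from configuration `c`. -/
def Halts (c : Cfg) : Prop := ∃ n : ℕ, steps n c = none

/-- Initial configuration: word `w` on the tape, head on its leftmost symbol, state `A`. -/
def initCfg (w : List Sym) : Cfg := ⟨St.A, 0, tapeOf w⟩

/-- Zipper configuration: `L` is the left half (nearest cell first), `R` the right half. -/
def mk (q : St) (L R : List Sym) (d : ℤ) : Cfg :=
  ⟨q, d, fun i => if d ≤ i then R.getD (i - d).toNat sb else L.getD (d - 1 - i).toNat sb⟩

/-- Zipper configuration whose head reads the first cell of the left half. -/
def pl (q : St) (L R : List Sym) (d : ℤ) : Cfg := mk q L.tail (L.headD sb :: R) d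

lemma steps_add (m n : ℕ) (c : Cfg) : steps (m + n) c = (steps m c).bind (steps n) := by
  induction m generalizing c with
  | zero => simp [steps]
  | succ m ih =>
    rw [Nat.succ_add]
    simp only [steps]
    cases step c with
    | none => rfl
    | some c' => simpa using ih c'

/-- Reachability, for all head offsets. -/
def Rc (F G : ℤ → Cfg) : Prop := ∀ d, ∃ s d', steps s (F d) = some (G d')

/-- Reachability in at least one step. -/
def Rp (F G : ℤ → Cfg) : Prop := ∀ d, ∃ s d', steps (s + 1) (F d) = some (G d')

lemma Rc.refl (F : ℤ → Cfg) : Rc F F := fun d => ⟨0, d, rfl⟩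

lemma Rc.trans {F G K : ℤ → Cfg} (h : Rc F G) (h' : Rc G K) : Rc F K := by
  intro d
  obtain ⟨s, d', e⟩ := h d
  obtain ⟨s', d'', e'⟩ := h' d'
  exact ⟨s + s', d'', by rw [steps_add, e]; exact e'⟩

lemma Rp.trans {F G K : ℤ → Cfg} (h : Rp F G) (h' : Rc G K) : Rp F K := by
  intro d
  obtain ⟨s, d', e⟩ := h d
  obtain ⟨s', d'', e'⟩ := h' d'
  exact ⟨s + s', d'', by rw [Nat.add_right_comm, steps_add, e]; exact e'⟩

lemma Rp.rc {F G : ℤ → Cfg} (h : Rp F G) : Rc F G := by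
  intro d
  obtain ⟨s, d', e⟩ := h d
  exact ⟨s + 1, d', e⟩

lemma mk_right {q a w q'} (h : delta q a = some (w, true, q')) (L R : List Sym) :
    Rp (mk q L (a :: R)) (mk q' (w :: L) R) := by
  intro d
  refine ⟨0, d + 1, ?_⟩
  have : step (mk q L (a :: R) d) = some (mk q' (w :: L) R (d + 1)) := by
    simp only [step, mk, le_refl, if_true, sub_self, Int.toNat_zero, List.getD_cons_zero, h,
      Option.map_some, Option.some.injEq, Cfg.mk.injEq, true_and]
    funext i
    rcases lt_trichotomy i d with hi | hi | hi
    · have e : (d + 1 - 1 - i).toNat = (d - 1 - i).toNat + 1 := by omega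
      rw [Function.update_of_ne (by omega), if_neg (by omega), if_neg (by omega), e,
        List.getD_cons_succ]
    · subst hi
      simp
    · have e : (i - d).toNat = (i - (d + 1)).toNat + 1 := by omega
      rw [Function.update_of_ne (by omega), if_pos (by omega), if_pos (by omega), e,
        List.getD_cons_succ]
  simp [steps, this]

lemma mk_left {q a w q'} (h : delta q a = some (w, false, q')) (L R : List Sym) :
    Rp (mk q L (a :: R)) (pl q' L (w :: R)) := by
  intro d
  refine ⟨0, d - 1, ?_⟩
  have : step (mk q L (a :: R) d) = some (pl q' L (w :: R) (d - 1)) := by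
    simp only [step, pl, mk, le_refl, if_true, sub_self, Int.toNat_zero, List.getD_cons_zero, h,
      Option.map_some, Option.some.injEq, Cfg.mk.injEq, true_and]
    refine ⟨rfl, ?_⟩
    funext i
    rcases lt_trichotomy i d with hi | hi | hi
    · rw [Function.update_of_ne (by omega), if_neg (by omega)]
      by_cases hj : i = d - 1
      · subst hj
        cases L <;> simp
      · have e : (d - 1 - i).toNat = (d - 1 - 1 - i).toNat + 1 := by omega
        rw [if_neg (by omega), e]
        cases L <;> simp
    · subst hi
      simp
    · have e : (i - d).toNat = (i - (d + 1)).toNat + 1 := by omega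
      have e' : (i - (d - 1)).toNat = (i - (d + 1)).toNat + 2 := by omega
      rw [Function.update_of_ne (by omega), if_pos (by omega), if_pos (by omega), e, e']
      simp
  simp [steps, this]

lemma mk_nil (q : St) (L : List Sym) : mk q L [] = mk q L [sb] := by
  funext d
  simp only [mk, Cfg.mk.injEq, true_and]
  funext i
  split_ifs
  · cases (i - d).toNat <;> simp
  · rfl

lemma pl_right {q a w q'} (h : delta q a = some (w, true, q')) (L R : List Sym) :
    Rc (pl q (a :: L) R) (mk q' (w :: L) R) := (mk_right h L R).rc

lemma pl_left {q a w q'} (h : delta q a = some (w, false, q')) (L R : List Sym) :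
    Rc (pl q (a :: L) R) (pl q' L (w :: R)) := (mk_left h L R).rc

lemma cons_rep (a : Sym) (m : ℕ) (L : List Sym) :
    List.replicate m a ++ a :: L = a :: (List.replicate m a ++ L) := by
  induction m with
  | zero => rfl
  | succ m ih => simp [List.replicate_succ, ih]

lemma sweep_right {q a w} (h : delta q a = some (w, true, q)) (m : ℕ) (L R : List Sym) :
    Rc (mk q L (List.replicate m a ++ R)) (mk q (List.replicate m w ++ L) R) := by
  induction m generalizing L with
  | zero => exact Rc.refl _
  | succ m ih =>
    have := (mk_right h L (List.replicate m a ++ R)).rc.trans (ih (w :: L))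
    rwa [cons_rep] at this

lemma sweep_left {q a w} (h : delta q a = some (w, false, q)) (m : ℕ) (L R : List Sym) :
    Rc (pl q (List.replicate m a ++ L) R) (pl q L (List.replicate m w ++ R)) := by
  induction m generalizing R with
  | zero => exact Rc.refl _
  | succ m ih =>
    have := (pl_left h (List.replicate m a ++ L) R).trans (ih (w :: R))
    rwa [cons_rep] at this

/-- From `B` at the left end of `r^j`, go to the right end, write `z`, and come back. -/
lemma turn (j : ℕ) (L : List Sym) :
    Rc (mk B L (List.replicate j sr)) (pl B L (List.replicate j st ++ [sz])) := by
  have h1 := sweep_right (q := B) (a := sr) (w := sy) rfl j L []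
  rw [List.append_nil, mk_nil] at h1
  exact (h1.trans (mk_left (q := B) (a := sb) rfl _ _).rc).trans
    (sweep_left (q := B) (a := sy) rfl j L [sz])

lemma round (m j : ℕ) (L : List Sym) :
    Rp (mk A L (List.replicate (m + 2) s1 ++ List.replicate j sr))
      (mk A (sx :: sx :: L) (List.replicate m s1 ++ List.replicate (j + 1) sr)) := by
  have h1 := mk_right (q := A) (a := s1) rfl L (List.replicate (m + 1) s1 ++ List.replicate j sr)
  have h2 := mk_right (q := C) (a := s1) rfl (sx :: L)
    (List.replicate m s1 ++ List.replicate j sr)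
  have h3 := sweep_right (q := B) (a := s1) rfl m (su :: sx :: L) (List.replicate j sr)
  have h4 := turn j (List.replicate m su ++ (su :: sx :: L))
  have h5 := sweep_left (q := B) (a := su) rfl m (su :: sx :: L) (List.replicate j st ++ [sz])
  have h6 := pl_left (q := B) (a := su) rfl (sx :: L)
    (List.replicate m sv ++ (List.replicate j st ++ [sz]))
  have h7 := pl_right (q := B) (a := sx) rfl L
    (sv :: (List.replicate m sv ++ (List.replicate j st ++ [sz])))
  have h8 := (mk_right (q := B) (a := sv) rfl (sx :: L)
    ((List.replicate m sv ++ (List.replicate j st ++ [sz])))).rc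
  have h9 := sweep_right (q := A) (a := sv) rfl m (su :: sx :: L) (List.replicate j st ++ [sz])
  have h10 := sweep_right (q := A) (a := st) rfl j
    (List.replicate m sx ++ (su :: sx :: L)) [sz]
  have h11 := (mk_left (q := A) (a := sz) rfl
    (List.replicate j sy ++ (List.replicate m sx ++ (su :: sx :: L))) []).rc
  have h12 := sweep_left (q := A) (a := sy) rfl j (List.replicate m sx ++ (su :: sx :: L)) [sr]
  have h13 := sweep_left (q := A) (a := sx) rfl m (su :: sx :: L) (List.replicate j sr ++ [sr])
  have h14 := pl_right (q := A) (a := su) rfl (sx :: L)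
    (List.replicate m s1 ++ (List.replicate j sr ++ [sr]))
  rw [List.replicate_succ' (n := j)]
  exact h1.trans (h2.rc.trans (h3.trans (h4.trans (h5.trans (h6.trans (h7.trans (h8.trans
    (h9.trans (h10.trans (h11.trans (h12.trans (h13.trans h14))))))))))))

lemma rounds (i m j : ℕ) (L : List Sym) :
    Rc (mk A L (List.replicate (m + 2 * i) s1 ++ List.replicate j sr))
      (mk A (List.replicate (2 * i) sx ++ L)
        (List.replicate m s1 ++ List.replicate (j + i) sr)) := by
  induction i generalizing j L with
  | zero => exact Rc.refl _
  | succ i ih =>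
    have h := (round (m + 2 * i) j L).rc.trans (ih (j + 1) (sx :: sx :: L))
    rw [cons_rep, cons_rep] at h
    have e : j + 1 + i = j + (i + 1) := by omega
    rw [e] at h
    exact h

lemma finish (i : ℕ) (L : List Sym) :
    Rc (mk B (List.replicate i sx ++ sb :: L) [sz]) (mk A (sb :: L) (List.replicate (i + 1) s1)) := by
  have h1 := (mk_left (q := B) (a := sz) rfl (List.replicate i sx ++ sb :: L) []).rc
  have h2 := sweep_left (q := A) (a := sx) rfl i (sb :: L) [s1]
  have h3 := pl_right (q := A) (a := sb) rfl L (List.replicate i s1 ++ [s1])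
  rw [List.replicate_succ']
  exact h1.trans (h2.trans h3)

lemma even_end (j : ℕ) (L : List Sym) :
    Rc (mk A L (List.replicate (j + 1) sr)) (mk A (sb :: L) (List.replicate (j + 1) s1)) := by
  have h1 := (mk_right (q := A) (a := sr) rfl L (List.replicate j sr)).rc
  have h2 := turn j (sk :: L)
  have h3 := pl_right (q := B) (a := sk) rfl L (List.replicate j st ++ [sz])
  have h4 := sweep_right (q := B) (a := st) rfl j (sb :: L) [sz]
  exact h1.trans (h2.trans (h3.trans (h4.trans (finish j L))))

lemma odd_end (i j : ℕ) (L : List Sym) :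
    Rc (mk A (List.replicate i sx ++ sb :: L) (s1 :: List.replicate (j + 1) sr))
      (mk A (sb :: L) (List.replicate (i + j + 3) s1)) := by
  have h1 := (mk_right (q := A) (a := s1) rfl (List.replicate i sx ++ sb :: L)
    (List.replicate (j + 1) sr)).rc
  have h2 := (mk_right (q := C) (a := sr) rfl (sx :: (List.replicate i sx ++ sb :: L))
    (List.replicate j sr)).rc
  have h3 := turn j (sy :: sx :: (List.replicate i sx ++ sb :: L))
  have h4 := pl_left (q := B) (a := sy) rfl (sx :: (List.replicate i sx ++ sb :: L))
    (List.replicate j st ++ [sz])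
  have h5 := pl_right (q := B) (a := sx) rfl (List.replicate i sx ++ sb :: L)
    (st :: (List.replicate j st ++ [sz]))
  have h6 := sweep_right (q := B) (a := st) rfl (j + 1)
    (sx :: (List.replicate i sx ++ sb :: L)) [sz]
  have h7 := finish (j + 1 + (i + 1)) L
  rw [List.replicate_add, List.append_assoc] at h7
  have e : i + j + 3 = j + 1 + (i + 1) + 1 := by omega
  rw [e]
  exact h1.trans (h2.trans (h3.trans (h4.trans (h5.trans (h6.trans h7)))))

lemma collatz_step (n : ℕ) (hn : 2 ≤ n) (L : List Sym) :
    ∃ L', Rp (mk A (sb :: L) (List.replicate n s1)) (mk A (sb :: L') (List.replicate (T n) s1)) := by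
  obtain ⟨i, hi⟩ : ∃ i, n = n % 2 + 2 * i + 2 := ⟨(n - 2) / 2, by omega⟩
  have h1 := (round (n % 2 + 2 * i) 0 (sb :: L)).trans
    (rounds i (n % 2) 1 (sx :: sx :: sb :: L))
  rw [← hi, cons_rep, cons_rep, List.replicate_zero, List.append_nil] at h1
  rcases Nat.mod_two_eq_zero_or_one n with h | h
  · rw [h] at h1 hi
    refine ⟨List.replicate (2 * i + 2) sx ++ sb :: L, ?_⟩
    have e : T n = i + 1 := by simp only [T, h, if_true]; omega
    rw [e]
    have h2 := even_end i (List.replicate (2 * i + 2) sx ++ sb :: L)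
    rw [Nat.add_comm 1 i] at h1
    exact h1.trans h2
  · rw [h] at h1 hi
    refine ⟨L, ?_⟩
    have e : T n = (2 * i + 2) + i + 3 := by
      simp only [T, h, one_ne_zero, if_false]; omega
    rw [e]
    rw [Nat.add_comm 1 i] at h1
    exact h1.trans (odd_end (2 * i + 2) i L)

lemma halts_one (L : List Sym) (d : ℤ) : Halts (mk A (sb :: L) (List.replicate 1 s1) d) := by
  have h1 := (mk_right (q := A) (a := s1) rfl (sb :: L) []).rc
  rw [mk_nil] at h1
  obtain ⟨s, d', e⟩ := h1.trans (mk_left (q := C) (a := sb) rfl _ _).rc d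
  exact ⟨s + 1, by rw [steps_add, show List.replicate 1 s1 = [s1] from rfl, e]; rfl⟩

lemma iter_of_halts (t : ℕ) : ∀ (n : ℕ) (L : List Sym) (d : ℤ), 0 < n →
    steps t (mk A (sb :: L) (List.replicate n s1) d) = none → ∃ k, T^[k] n = 1 := by
  induction t using Nat.strong_induction_on with
  | _ t ih =>
    intro n L d hn ht
    by_cases h1 : n = 1
    · exact ⟨0, h1⟩
    obtain ⟨L', h⟩ := collatz_step n (by omega) L
    obtain ⟨s, d', e⟩ := h d
    have hlt : s + 1 < t ∨ t ≤ s + 1 := by omega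
    rcases hlt with hlt | hle
    · obtain ⟨r, rfl⟩ := Nat.exists_eq_add_of_lt hlt
      rw [Nat.add_assoc (s + 1) r 1, steps_add, e] at ht
      have hT : 0 < T n := by unfold T; split_ifs <;> omega
      obtain ⟨k, hk⟩ := ih (r + 1) (by omega) (T n) L' d' hT ht
      exact ⟨k + 1, hk⟩
    · obtain ⟨r, hr⟩ := Nat.exists_eq_add_of_le hle
      rw [hr, steps_add, ht] at e
      cases e

lemma halts_of_iter (k : ℕ) : ∀ (n : ℕ) (L : List Sym) (d : ℤ), 0 < n →
    T^[k] n = 1 → Halts (mk A (sb :: L) (List.replicate n s1) d) := by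
  induction k with
  | zero =>
    intro n L d _ h
    have h : n = 1 := h
    subst h
    exact halts_one L d
  | succ k ih =>
    intro n L d hn h
    by_cases h1 : n = 1
    · subst h1
      exact halts_one L d
    obtain ⟨L', hs⟩ := collatz_step n (by omega) L
    obtain ⟨s, d', e⟩ := hs d
    have hT : 0 < T n := by unfold T; split_ifs <;> omega
    obtain ⟨t, ht⟩ := ih (T n) L' d' hT h
    exact ⟨s + 1 + t, by rw [steps_add, e]; exact ht⟩

lemma start_eq (w : List Sym) : initCfg w = mk A [sb] w 0 := by
  simp only [initCfg, mk, Cfg.mk.injEq, true_and]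
  funext i
  simp only [tapeOf, sub_zero]
  split_ifs
  · rfl
  · cases (0 - 1 - i).toNat <;> simp

/-- The 3x+1 conjecture holds iff for every positive integer `n`, the machine `M3`
halts when started from `ωb (A 1) 1^{n-1} bω` (the number `n` in unary). -/
theorem collatz_iff_M3_halts :
    CollatzConjecture ↔
      ∀ n : ℕ, 0 < n → Halts (initCfg (List.replicate n s1)) := by
  constructor
  · intro h n hn
    obtain ⟨k, -, hk⟩ := h n hn
    rw [start_eq]
    exact halts_of_iter (k + 1) n [] 0 hn hk
  · intro h n hn
    obtain ⟨t, ht⟩ := h n hn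
    rw [start_eq] at ht
    obtain ⟨k, hk⟩ := iter_of_halts t n [] 0 hn ht
    refine ⟨k + 1, ?_, ?_⟩
    · rw [Function.iterate_succ_apply', hk]; rfl
    · rw [Function.iterate_succ_apply', Function.iterate_succ_apply', hk]; rfl

end Collatz
end

section
/- For every positive integer n, the Turing machine M3 halts when started from the initial configuration ωb (A 1) 1^{n−1} bω if and only if there exists m ≥ 0 with T^m(n) = 1. -/
namespace Collatz

open St Sym

/-- `c` is in state `q`, with `l` the (reversed) tape left of the head and `r` the tape from the head. -/
def Rep (c : Cfg) (q : St) (l r : List Sym) : Prop :=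
  c.state = q ∧ (∀ k : ℕ, c.tape (c.head + k) = r.getD k sb) ∧
    (∀ k : ℕ, c.tape (c.head - 1 - k) = l.getD k sb)

structure Conf where
  q : St
  l : List Sym
  r : List Sym

/-- Head on the first symbol of `r`. -/
abbrev RC (q : St) (l r : List Sym) : Conf := ⟨q, l, r⟩
/-- Head on the first symbol of `l`. -/
abbrev LC (q : St) (l r : List Sym) : Conf := ⟨q, l.tail, l.headD sb :: r⟩

def Go (a b : Conf) : Prop :=
  ∀ c, Rep c a.q a.l a.r → ∃ t c', steps t c = some c' ∧ Rep c' b.q b.l b.r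

theorem steps_add_s6 (s t : ℕ) (c c' : Cfg) (h : steps s c = some c') :
    steps (s + t) c = steps t c' := by
  induction s generalizing c with
  | zero => simp [steps] at h; simp [h]
  | succ s ih =>
    rw [Nat.succ_add]
    simp only [steps] at h ⊢
    cases hs : step c with
    | none => simp [hs] at h
    | some d => simp [hs] at h ⊢; exact ih d h

theorem Go.refl (a : Conf) : Go a a := fun c h => ⟨0, c, rfl, h⟩

theorem Go.trans {a b d : Conf} (h1 : Go a b) (h2 : Go b d) : Go a d := by
  intro c hc
  obtain ⟨s, c1, e1, r1⟩ := h1 c hc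
  obtain ⟨t, c2, e2, r2⟩ := h2 c1 r1
  exact ⟨s + t, c2, by rw [steps_add_s6 s t c c1 e1, e2], r2⟩

theorem step_right {c : Cfg} {q q' : St} {s s' : Sym} {l r : List Sym}
    (hd : delta q s = some (s', true, q')) (h : Rep c q l (s :: r)) :
    ∃ c', step c = some c' ∧ Rep c' q' (s' :: l) r := by
  obtain ⟨h1, h2, h3⟩ := h
  have h0 : c.tape c.head = s := by simpa using h2 0
  refine ⟨_, by simp only [step, h1, h0, hd]; rfl, rfl, ?_, ?_⟩
  · intro k
    have := h2 (k + 1)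
    simp only [List.getD_cons_succ] at this
    simp only [if_true]
    rw [Function.update_of_ne (by omega), ← this]
    congr 1; push_cast; ring
  · intro k
    simp only [if_true]
    cases k with
    | zero => simp
    | succ k =>
      have := h3 k
      rw [Function.update_of_ne (by omega), List.getD_cons_succ, ← this]
      congr 1; push_cast; ring

theorem step_left {c : Cfg} {q q' : St} {s s' : Sym} {l r : List Sym}
    (hd : delta q s = some (s', false, q')) (h : Rep c q l (s :: r)) :
    ∃ c', step c = some c' ∧ Rep c' q' l.tail (l.headD sb :: s' :: r) := by
  obtain ⟨h1, h2, h3⟩ := h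
  have h0 : c.tape c.head = s := by simpa using h2 0
  refine ⟨_, by simp only [step, h1, h0, hd]; rfl, rfl, ?_, ?_⟩
  · intro k
    simp only [Bool.false_eq_true, if_false]
    rcases k with _ | _ | k
    · have := h3 0
      rw [Function.update_of_ne (by omega)]
      simp only [Nat.cast_zero, sub_zero] at this
      simp only [Nat.cast_zero, add_zero, List.getD_cons_zero]
      rw [← sub_eq_add_neg, this]
      cases l <;> rfl
    · simp
    · have := h2 (k + 1)
      rw [Function.update_of_ne (by omega)]
      simp only [List.getD_cons_succ] at this ⊢
      rw [← this]
      congr 1; push_cast; ring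
  · intro k
    have := h3 (k + 1)
    simp only [Bool.false_eq_true, if_false]
    rw [Function.update_of_ne (by omega)]
    have e : l.tail.getD k sb = l.getD (k + 1) sb := by cases l <;> simp
    rw [e, ← this]
    congr 1; push_cast; ring

theorem Rep.blank {c : Cfg} {q : St} {l : List Sym} (h : Rep c q l []) : Rep c q l [sb] := by
  obtain ⟨h1, h2, h3⟩ := h
  refine ⟨h1, fun k => ?_, h3⟩
  rw [h2 k]
  cases k <;> simp

theorem steps_one {c c' : Cfg} (h : step c = some c') : steps 1 c = some c' := by
  simp [steps, h]

theorem goR {q q' : St} {s s' : Sym} (l r : List Sym)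
    (hd : delta q s = some (s', true, q')) : Go (RC q l (s :: r)) (RC q' (s' :: l) r) := by
  intro c h
  obtain ⟨c', h1, h2⟩ := step_right hd h
  exact ⟨1, c', steps_one h1, h2⟩

theorem goL {q q' : St} {s s' : Sym} (l r : List Sym)
    (hd : delta q s = some (s', false, q')) : Go (RC q l (s :: r)) (LC q' l (s' :: r)) := by
  intro c h
  obtain ⟨c', h1, h2⟩ := step_left hd h
  exact ⟨1, c', steps_one h1, h2⟩

theorem goBlank (q : St) (l : List Sym) : Go (RC q l []) (RC q l [sb]) :=
  fun c h => ⟨0, c, rfl, h.blank⟩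

theorem rep_shift (k : ℕ) (a : Sym) (l : List Sym) :
    List.replicate k a ++ a :: l = List.replicate (k + 1) a ++ l := by
  induction k with
  | zero => rfl
  | succ k ih => rw [List.replicate_succ, List.cons_append, ih]; rfl

theorem sweepR {q : St} {s s' : Sym} (hd : delta q s = some (s', true, q)) (k : ℕ)
    (l r : List Sym) :
    Go (RC q l (List.replicate k s ++ r)) (RC q (List.replicate k s' ++ l) r) := by
  induction k generalizing l with
  | zero => exact Go.refl _
  | succ k ih =>
    have := (goR l (List.replicate k s ++ r) hd).trans (ih (s' :: l))
    rw [rep_shift] at this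
    exact this

theorem sweepL {q : St} {s s' : Sym} (hd : delta q s = some (s', false, q)) (k : ℕ)
    (l r : List Sym) :
    Go (LC q (List.replicate k s ++ l) r) (LC q l (List.replicate k s' ++ r)) := by
  induction k generalizing r with
  | zero => exact Go.refl _
  | succ k ih =>
    have := (goL (List.replicate k s ++ l) r hd).trans (ih (s' :: r))
    rw [rep_shift] at this
    exact this

/-- Odd case, at the end of the halving loop. -/
theorem goOdd (j : ℕ) (X L : List Sym) (hX : X = List.replicate (2 * j + 3) sx ++ sb :: L) :
    Go (RC C X (List.replicate (j + 1) sr)) (RC A (sb :: L) (List.replicate (3 * j + 5) s1)) := by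
  refine (goR (q' := B) (s' := sy) X (List.replicate j sr) rfl).trans ?_
  have h1 := sweepR (q := B) (s := sr) (s' := sy) rfl j (sy :: X) []
  rw [List.append_nil, rep_shift] at h1
  refine h1.trans ((goBlank _ _).trans ((goL _ _ (q' := B) (s' := sz) rfl).trans ?_))
  refine (sweepL (s' := st) rfl _ _ _).trans ?_
  have hX' : X = sx :: (List.replicate (2 * j + 2) sx ++ sb :: L) := by rw [hX]; rfl
  have h2 := goR (q := B) (q' := B) (s := sx) (s' := sx) (List.replicate (2 * j + 2) sx ++ sb :: L)
    (List.replicate (j + 1) st ++ [sz]) rfl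
  rw [← hX'] at h2
  have h3 : Go (LC B X (List.replicate (j + 1) st ++ [sz]))
      (RC B X (List.replicate (j + 1) st ++ [sz])) := by
    have : LC B X (List.replicate (j + 1) st ++ [sz]) =
      RC B (List.replicate (2 * j + 2) sx ++ sb :: L)
        (sx :: (List.replicate (j + 1) st ++ [sz])) := by rw [hX']; rfl
    rw [this]; exact h2
  refine h3.trans ((sweepR (s' := sx) rfl _ _ _).trans ?_)
  refine (goL _ _ (q' := A) (s' := s1) rfl).trans ?_
  refine (sweepL (s' := s1) rfl _ _ _).trans ?_
  rw [hX]
  refine (sweepL (s' := s1) rfl _ _ _).trans ?_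
  have h4 := goR (q := A) (q' := A) (s := sb) (s' := sb) L
    (List.replicate (2 * j + 3) s1 ++ (List.replicate (j + 1) s1 ++ [s1])) rfl
  have e : List.replicate (2 * j + 3) s1 ++ (List.replicate (j + 1) s1 ++ [s1])
      = List.replicate (3 * j + 5) s1 := by
    rw [rep_shift, List.append_nil, List.replicate_append_replicate]
    congr 1; ring
  rw [e] at h4 ⊢
  exact h4

/-- One pass of the loop. -/
theorem goPass (j m : ℕ) (Y : List Sym) :
    Go (RC C (sx :: Y) (List.replicate (m + 1) s1 ++ List.replicate j sr))
      (RC A (sx :: sx :: Y) (List.replicate m s1 ++ List.replicate (j + 1) sr)) := by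
  refine (goR (q' := B) (s' := su) _ (List.replicate m s1 ++ List.replicate j sr) rfl).trans ?_
  refine (sweepR (s' := su) rfl _ _ _).trans ?_
  have h1 := sweepR (q := B) (s := sr) (s' := sy) rfl j
    (List.replicate m su ++ su :: sx :: Y) []
  rw [List.append_nil] at h1
  refine h1.trans ((goBlank _ _).trans ((goL _ _ (q' := B) (s' := sz) rfl).trans ?_))
  refine (sweepL (s' := st) rfl _ _ _).trans ?_
  refine (sweepL (s' := sv) rfl _ _ _).trans ?_
  refine (goL (q := B) (s := su) (s' := sv) (q' := B) (sx :: Y) _ rfl).trans ?_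
  refine (goR (q := B) (s := sx) (s' := sx) (q' := B) Y _ rfl).trans ?_
  refine (goR (q := B) (s := sv) (s' := su) (q' := A) _ _ rfl).trans ?_
  refine (sweepR (s' := sx) rfl _ _ _).trans ?_
  refine (sweepR (s' := sy) rfl _ _ _).trans ?_
  refine (goL _ _ (q' := A) (s' := sr) rfl).trans ?_
  refine (sweepL (s' := sr) rfl _ _ _).trans ?_
  refine (sweepL (s' := s1) rfl _ _ _).trans ?_
  rw [rep_shift, List.append_nil]
  exact goR (q := A) (s := su) (s' := sx) (q' := A) _ _ rfl

/-- Even case, at the end of the halving loop. -/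
theorem goEven (j : ℕ) (X : List Sym) :
    Go (RC A X (List.replicate (j + 1) sr)) (RC A (sb :: X) (List.replicate (j + 1) s1)) := by
  refine (goR (q' := B) (s' := sk) X (List.replicate j sr) rfl).trans ?_
  have h1 := sweepR (q := B) (s := sr) (s' := sy) rfl j (sk :: X) []
  rw [List.append_nil] at h1
  refine h1.trans ((goBlank _ _).trans ((goL _ _ (q' := B) (s' := sz) rfl).trans ?_))
  refine (sweepL (s' := st) rfl _ _ _).trans ?_
  refine (goR (q := B) (s := sk) (s' := sb) (q' := B) _ _ rfl).trans ?_
  refine (sweepR (s' := sx) rfl _ _ _).trans ?_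
  refine (goL _ _ (q' := A) (s' := s1) rfl).trans ?_
  refine (sweepL (s' := s1) rfl _ _ _).trans ?_
  rw [rep_shift, List.append_nil]
  exact goR (q := A) (s := sb) (s' := sb) (q' := A) _ _ rfl

theorem goLoop (m : ℕ) : ∀ (j : ℕ) (L : List Sym), 0 < m + j →
    ∃ L', Go (RC C (List.replicate (2 * j + 1) sx ++ sb :: L)
      (List.replicate m s1 ++ List.replicate j sr))
      (RC A (sb :: L') (List.replicate (T (2 * j + m + 1)) s1)) := by
  induction m using Nat.strong_induction_on with
  | _ m ih =>
    intro j L h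
    rcases m with _ | _ | m
    · obtain ⟨i, rfl⟩ : ∃ i, j = i + 1 := ⟨j - 1, by omega⟩
      refine ⟨L, ?_⟩
      have e : T (2 * (i + 1) + 0 + 1) = 3 * i + 5 := by
        unfold T; rw [if_neg (by omega)]; omega
      rw [e]
      exact goOdd i _ L rfl
    · refine ⟨sx :: sx :: (List.replicate (2 * j) sx ++ sb :: L), (goPass j 0 (List.replicate (2 * j) sx ++ sb :: L)).trans ?_⟩
      have e : T (2 * j + (0 + 1) + 1) = j + 1 := by
        unfold T; rw [if_pos (by omega)]; omega
      rw [e]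
      exact goEven j _
    · obtain ⟨L', hL⟩ := ih m (by omega) (j + 1) L (by omega)
      refine ⟨L', (goPass j (m + 1) (List.replicate (2 * j) sx ++ sb :: L)).trans ?_⟩
      have e : 2 * j + (m + 1 + 1) + 1 = 2 * (j + 1) + m + 1 := by ring
      rw [e]
      exact (goR (q := A) (s := s1) (s' := sx) (q' := C) _ _ rfl).trans hL

def Good (n : ℕ) (c : Cfg) : Prop := ∃ L, Rep c A (sb :: L) (List.replicate n s1)

theorem good_step {n : ℕ} (hn : 2 ≤ n) {c : Cfg} (h : Good n c) :
    ∃ t c', steps (t + 1) c = some c' ∧ Good (T n) c' := by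
  obtain ⟨L, h⟩ := h
  obtain ⟨m, rfl⟩ : ∃ m, n = m + 1 := ⟨n - 1, by omega⟩
  obtain ⟨c1, h1, h2⟩ := step_right (q := A) (s := s1) (s' := sx) (q' := C) rfl h
  obtain ⟨L', hL⟩ := goLoop m 0 L (by omega)
  obtain ⟨t, c', h3, h4⟩ := hL c1 (by simpa using h2)
  refine ⟨t, c', by simp [steps, h1, h3], L', ?_⟩
  simpa using h4

theorem good_halt {c : Cfg} (h : Good 1 c) : Halts c := by
  obtain ⟨L, h⟩ := h
  obtain ⟨c1, h1, h2⟩ := step_right (q := A) (s := s1) (s' := sx) (q' := C) rfl h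
  obtain ⟨c2, h3, h4⟩ := step_left (q := C) (s := sb) (s' := sb) (q' := H) rfl h2.blank
  refine ⟨3, ?_⟩
  have : step c2 = none := by simp [step, h4.1, delta]
  simp [steps, h1, h3, this]

theorem T_pos {n : ℕ} (hn : 0 < n) : 0 < T n := by
  unfold T; split_ifs <;> omega

theorem halts_of_iter_s6 (m : ℕ) : ∀ (n : ℕ) (c : Cfg), 0 < n → Good n c → T^[m] n = 1 →
    Halts c := by
  induction m with
  | zero =>
    intro n c _ h e
    simp at e; subst e; exact good_halt h
  | succ m ih =>
    intro n c hn h e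
    by_cases h1 : n = 1
    · subst h1; exact good_halt h
    obtain ⟨t, c', hs, hg⟩ := good_step (by omega) h
    obtain ⟨k, hk⟩ := ih (T n) c' (T_pos hn) hg (by simpa using e)
    exact ⟨t + 1 + k, by rw [steps_add_s6 _ _ _ _ hs, hk]⟩

theorem steps_none_add (s t : ℕ) (c : Cfg) (h : steps s c = none) : steps (s + t) c = none := by
  induction s generalizing c with
  | zero => simp [steps] at h
  | succ s ih =>
    rw [Nat.succ_add]
    simp only [steps] at h ⊢
    cases hs : step c with
    | none => simp
    | some d => simp [hs] at h ⊢; exact ih d h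

theorem iter_of_halts_s6 (k : ℕ) : ∀ (n : ℕ) (c : Cfg), 0 < n → Good n c → steps k c = none →
    ∃ m, T^[m] n = 1 := by
  induction k using Nat.strong_induction_on with
  | _ k ih =>
    intro n c hn h e
    by_cases h1 : n = 1
    · exact ⟨0, h1⟩
    obtain ⟨t, c', hs, hg⟩ := good_step (by omega) h
    have hlt : t + 1 < k := by
      by_contra hc
      have := steps_none_add k (t + 1 - k) c e
      rw [Nat.add_sub_cancel' (by omega), hs] at this
      simp at this
    obtain ⟨d, rfl⟩ : ∃ d, k = t + 1 + d := ⟨k - (t + 1), by omega⟩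
    rw [steps_add_s6 _ _ _ _ hs] at e
    obtain ⟨m, hm⟩ := ih d (by omega) (T n) c' (T_pos hn) hg e
    exact ⟨m + 1, by simpa using hm⟩

theorem good_init (n : ℕ) : Good n (initCfg (List.replicate n s1)) := by
  refine ⟨[], rfl, fun k => ?_, fun k => ?_⟩
  · simp [initCfg, tapeOf]
  · have : ¬ (0 : ℤ) ≤ 0 - 1 - (k : ℤ) := by omega
    simp only [initCfg, tapeOf, if_neg this]
    cases k <;> simp

/-- For every positive integer `n`, the machine `M3` halts when started from
`ωb (A 1) 1^{n-1} bω` iff some iterate of `T` at `n` is `1`. -/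
theorem M3_halts_iff_iterate_one (n : ℕ) (hn : 0 < n) :
    Halts (initCfg (List.replicate n s1)) ↔ (∃ m : ℕ, T^[m] n = 1) := by
  constructor
  · rintro ⟨k, hk⟩
    exact iter_of_halts_s6 k n _ hn (good_init n) hk
  · rintro ⟨m, hm⟩
    exact halts_of_iter_s6 m n _ hn (good_init n) hm

end Collatz
end
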